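/- arXiv:2601.06745 — 4 statements merged into one kernel-verified Lean document; each statement's English description precedes it below -/
import Mathlib

section
/- Let K ≥ 2 and let E₁,…,E_K be closed proper subspaces of a complex Hilbert space H, with E = ⋂_{i=1}^K E_i. Assume r(P_{E₁}P_{E₂}⋯P_{E_K} − P_E) < 1. Then for every integer g ≥ 2 and every choice of nonempty proper subsets I₁,…,I_g of {1,…,K} with ⋃_{d=1}^g I_d = {1,…,K}, setting F_d = ⋂_{i∈I_d} E_i for d = 1,…,g, one has r(P_{F₁}P_{F₂}⋯P_{F_g} − P_E) < 1, and moreover r(∑_{d=1}^g w_d P_{F_d} − P_E) < 1 for every (w₁,…,w_g) ∈ 𝒮_g. -/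
open scoped ENNReal
set_option linter.unusedSectionVars false

variable {H : Type*} [NormedAddCommGroup H] [InnerProductSpace ℂ H] [CompleteSpace H]

/-- The orthogonal projection onto a closed subspace, as an operator on the ambient space. -/
noncomputable def proj (S : Submodule ℂ H) (hS : IsClosed (S : Set H)) : H →L[ℂ] H :=
  haveI : CompleteSpace S := hS.completeSpace_coe
  S.subtypeL.comp (Submodule.orthogonalProjectionOnto S)

lemma isClosed_iInf {ι : Sort*} {S : ι → Submodule ℂ H} (h : ∀ i, IsClosed ((S i : Set H))) :
    IsClosed ((⨅ i, S i : Submodule ℂ H) : Set H) := by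
  rw [Submodule.coe_iInf]
  exact isClosed_iInter h

lemma isClosed_biInf {K : ℕ} {E : Fin K → Submodule ℂ H} (hE : ∀ i, IsClosed ((E i : Set H)))
    (s : Finset (Fin K)) : IsClosed ((⨅ i ∈ s, E i : Submodule ℂ H) : Set H) :=
  isClosed_iInf fun i => isClosed_iInf fun _ => hE i

lemma le_of_sq_le_sq' {a b : ℝ} (h : a ^ 2 ≤ b ^ 2) (hb : 0 ≤ b) : a ≤ b :=
  abs_le_of_sq_le_sq' h hb |>.2

lemma proj_mem (S : Submodule ℂ H) (hS : IsClosed (S : Set H)) (x : H) : proj S hS x ∈ S := by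
  simp [proj]

lemma proj_of_mem (S : Submodule ℂ H) (hS : IsClosed (S : Set H)) {x : H} (hx : x ∈ S) :
    proj S hS x = x := by
  haveI : CompleteSpace S := hS.completeSpace_coe
  exact Submodule.starProjection_eq_self_iff.2 hx

lemma proj_inner (S : Submodule ℂ H) (hS : IsClosed (S : Set H)) (x : H) {y : H} (hy : y ∈ S) :
    inner ℂ (x - proj S hS x) y = 0 := by
  haveI : CompleteSpace S := hS.completeSpace_coe
  exact Submodule.starProjection_inner_eq_zero (K := S) x y hy

lemma proj_pyth_mem (S : Submodule ℂ H) (hS : IsClosed (S : Set H)) (x : H) {y : H} (hy : y ∈ S) :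
    ‖x - y‖ ^ 2 = ‖x - proj S hS x‖ ^ 2 + ‖proj S hS x - y‖ ^ 2 := by
  have h := norm_add_sq_eq_norm_sq_add_norm_sq_of_inner_eq_zero (𝕜 := ℂ) (x - proj S hS x)
    (proj S hS x - y) (proj_inner S hS x (S.sub_mem (proj_mem S hS x) hy))
  rw [sub_add_sub_cancel] at h
  simpa [sq] using h

lemma proj_pyth (S : Submodule ℂ H) (hS : IsClosed (S : Set H)) (x : H) :
    ‖x‖ ^ 2 = ‖x - proj S hS x‖ ^ 2 + ‖proj S hS x‖ ^ 2 := by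
  simpa using proj_pyth_mem S hS x S.zero_mem

lemma proj_dist_le (S : Submodule ℂ H) (hS : IsClosed (S : Set H)) (x : H) {y : H} (hy : y ∈ S) :
    ‖x - proj S hS x‖ ≤ ‖x - y‖ := by
  have h := proj_pyth_mem S hS x hy
  have := sq_nonneg ‖proj S hS x - y‖
  exact le_of_sq_le_sq' (by linarith) (norm_nonneg _)

lemma proj_norm_le (S : Submodule ℂ H) (hS : IsClosed (S : Set H)) (x : H) :
    ‖proj S hS x‖ ≤ ‖x‖ := by
  have h := proj_pyth S hS x
  have := sq_nonneg ‖x - proj S hS x‖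
  exact le_of_sq_le_sq' (by linarith) (norm_nonneg _)

/-- `T` is the orthogonal projection onto some closed subspace. -/
def IsPr (T : H →L[ℂ] H) : Prop := ∃ (S : Submodule ℂ H) (hS : IsClosed (S : Set H)), T = proj S hS

lemma prod_fix (L : List (H →L[ℂ] H)) (x : H) (h : ∀ T ∈ L, T x = x) : L.prod x = x := by
  induction L with
  | nil => simp
  | cons T L ih =>
    have h1 := ih fun T' hT' => h T' (by simp [hT'])
    simp [h1, h T (by simp)]

lemma prod_sub_le (L : List (H →L[ℂ] H)) (hL : ∀ T ∈ L, IsPr T) (x : H) (B : ℝ)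
    (h : ∀ T ∈ L, ‖x - T x‖ ≤ B) : ‖x - L.prod x‖ ≤ L.length * B := by
  induction L with
  | nil => simp
  | cons T L ih =>
    have h1 := ih (fun T' hT' => hL T' (by simp [hT'])) fun T' hT' => h T' (by simp [hT'])
    have h2 := h T (by simp)
    obtain ⟨S, hS, rfl⟩ := hL T (by simp)
    have h3 := proj_norm_le S hS (x - L.prod x)
    have h4 : x - (proj S hS :: L).prod x
        = (x - proj S hS x) + proj S hS (x - L.prod x) := by simp
    rw [h4]
    have h5 := norm_add_le (x - proj S hS x) (proj S hS (x - L.prod x))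
    push_cast [List.length_cons]
    linarith

lemma prod_defect (L : List (H →L[ℂ] H)) (hL : ∀ T ∈ L, IsPr T) (x : H) :
    ‖x - L.prod x‖ ^ 2 ≤ 2 ^ L.length * (‖x‖ ^ 2 - ‖L.prod x‖ ^ 2) ∧
    ∀ T ∈ L, ‖x - T x‖ ^ 2 ≤ 2 ^ L.length * (‖x‖ ^ 2 - ‖L.prod x‖ ^ 2) := by
  induction L with
  | nil => simp
  | cons T L ih =>
    obtain ⟨h1, h2⟩ := ih (fun T' hT' => hL T' (by simp [hT']))
    obtain ⟨S, hS, rfl⟩ := hL T (by simp)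
    have e : (proj S hS :: L).prod x = proj S hS (L.prod x) := by simp
    rw [e]
    generalize L.prod x = y at *
    have hp := proj_pyth S hS y
    have hc : (1 : ℝ) ≤ 2 ^ L.length := one_le_pow₀ (by norm_num)
    rw [List.length_cons, pow_succ (2 : ℝ) L.length]
    generalize (2 : ℝ) ^ L.length = c at *
    have hA : 0 ≤ ‖x‖ ^ 2 - ‖y‖ ^ 2 := by
      by_contra hneg
      have := sq_nonneg ‖x - y‖
      nlinarith
    have hB := sq_nonneg ‖y - proj S hS y‖
    have h3 : ‖x - proj S hS y‖ ^ 2 ≤ c * 2 * (‖x‖ ^ 2 - ‖proj S hS y‖ ^ 2) := by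
      have ht : ‖x - proj S hS y‖ ≤ ‖x - y‖ + ‖y - proj S hS y‖ := norm_sub_le_norm_sub_add_norm_sub _ _ _
      have hq : ‖x - proj S hS y‖ ^ 2 ≤ (‖x - y‖ + ‖y - proj S hS y‖) ^ 2 := by gcongr
      nlinarith [sq_nonneg (‖x - y‖ - ‖y - proj S hS y‖)]
    refine ⟨h3, ?_⟩
    intro T hT
    rcases List.mem_cons.1 hT with rfl | hT
    · refine le_trans ?_ h3
      gcongr
      exact proj_dist_le S hS x (proj_mem S hS y)
    · have := h2 T hT
      nlinarith

lemma gap_of_defect [Nontrivial H] (E : Submodule ℂ H) (hE : IsClosed (E : Set H))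
    (S : H →L[ℂ] H) (hfix : ∀ x ∈ E, S x = x) (D : ℝ)
    (hD : ∀ u, proj E hE u = 0 → ‖u‖ ^ 2 ≤ D * (‖u‖ ^ 2 - ‖S u‖ ^ 2))
    (hS : ∀ u, ‖S u‖ ≤ ‖u‖) :
    spectralRadius ℂ (S - proj E hE) < 1 := by
  set D' := max D 1 with hD'
  have hD1 : 1 ≤ D' := le_max_right _ _
  have hq0 : 0 ≤ 1 - 1 / D' := by
    have : 1 / D' ≤ 1 := by rw [div_le_one (by linarith)]; exact hD1
    linarith
  have hbound : ∀ x, ‖(S - proj E hE) x‖ ≤ √(1 - 1 / D') * ‖x‖ := by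
    intro x
    set u := x - proj E hE x with hu
    have h1 : (S - proj E hE) x = S u := by
      simp [hu, hfix _ (proj_mem E hE x)]
    have h2 : proj E hE u = 0 := by
      simp [hu, proj_of_mem E hE (proj_mem E hE x)]
    have h3 : ‖u‖ ≤ ‖x‖ := by
      simpa using proj_dist_le E hE x E.zero_mem
    have h4 := hD u h2
    have h5 : ‖S u‖ ^ 2 ≤ ‖u‖ ^ 2 := by have := hS u; gcongr
    have h6 : ‖u‖ ^ 2 ≤ D' * (‖u‖ ^ 2 - ‖S u‖ ^ 2) :=
      h4.trans (mul_le_mul_of_nonneg_right (le_max_left _ _) (by linarith))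
    have h7 : ‖S u‖ ^ 2 ≤ (1 - 1 / D') * ‖u‖ ^ 2 := by
      have : ‖u‖ ^ 2 / D' ≤ ‖u‖ ^ 2 - ‖S u‖ ^ 2 := by
        rw [div_le_iff₀ (by linarith)]; linarith
      have e : (1 - 1 / D') * ‖u‖ ^ 2 = ‖u‖ ^ 2 - ‖u‖ ^ 2 / D' := by ring
      linarith
    rw [h1]
    refine le_trans ?_ (mul_le_mul_of_nonneg_left h3 (Real.sqrt_nonneg _))
    refine le_of_sq_le_sq' ?_ (by positivity)
    rw [mul_pow, Real.sq_sqrt hq0]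
    exact h7
  have hn : ‖S - proj E hE‖ < 1 := by
    refine lt_of_le_of_lt (ContinuousLinearMap.opNorm_le_bound _ (Real.sqrt_nonneg _) hbound) ?_
    rw [Real.sqrt_lt' one_pos]
    have : 0 < 1 / D' := by positivity
    linarith
  refine lt_of_le_of_lt (spectrum.spectralRadius_le_nnnorm _) ?_
  exact_mod_cast hn

lemma lower_of_gap (T : H →L[ℂ] H) (h : spectralRadius ℂ T < 1) :
    ∃ C : ℝ, 0 ≤ C ∧ ∀ x, ‖x‖ ≤ C * ‖x - T x‖ := by
  have h1 : (1 : ℂ) ∈ resolventSet ℂ T :=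
    spectrum.mem_resolventSet_of_spectralRadius_lt (by simpa using h)
  rw [spectrum.mem_resolventSet_iff, map_one] at h1
  obtain ⟨v, hv⟩ := h1.exists_left_inv
  refine ⟨‖v‖, norm_nonneg _, fun x => ?_⟩
  have e : v (x - T x) = x := by
    have := congrArg (fun A : H →L[ℂ] H => A x) hv
    simpa using this
  calc ‖x‖ = ‖v (x - T x)‖ := by rw [e]
    _ ≤ _ := v.le_opNorm _

lemma mix_defect {g : ℕ} (P : Fin g → H →L[ℂ] H) (hP : ∀ d, IsPr (P d)) (w : Fin g → ℝ)
    (hw : ∀ d, 0 < w d) (hw1 : ∑ d, w d = 1) (x : H) :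
    ∑ d, w d * ‖x - P d x‖ ^ 2 ≤ ‖x‖ ^ 2 - ‖(∑ d, (w d : ℂ) • P d) x‖ ^ 2 := by
  have h1 : ‖(∑ d, (w d : ℂ) • P d) x‖ ≤ ∑ d, w d * ‖P d x‖ := by
    rw [ContinuousLinearMap.sum_apply]
    refine (norm_sum_le _ _).trans (le_of_eq ?_)
    refine Finset.sum_congr rfl fun d _ => ?_
    simp [norm_smul, abs_of_pos (hw d)]
  have h2 : (∑ d, w d * ‖P d x‖) ^ 2 ≤ ∑ d, w d * ‖P d x‖ ^ 2 :=
    by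
    exact Real.pow_arith_mean_le_arith_mean_pow Finset.univ w (fun d => ‖P d x‖)
      (fun d _ => (hw d).le) hw1 (fun d _ => norm_nonneg _) 2
  have h3 : ‖(∑ d, (w d : ℂ) • P d) x‖ ^ 2 ≤ (∑ d, w d * ‖P d x‖) ^ 2 := by gcongr
  have h4 : ‖x‖ ^ 2 = ∑ d, w d * ‖x - P d x‖ ^ 2 + ∑ d, w d * ‖P d x‖ ^ 2 := by
    rw [← Finset.sum_add_distrib, ← one_mul (‖x‖ ^ 2), ← hw1, Finset.sum_mul]
    refine Finset.sum_congr rfl fun d _ => ?_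
    obtain ⟨S, hS, e⟩ := hP d
    rw [e, proj_pyth S hS x]; ring
  linarith


/-- If the full deterministic-scan Gibbs sampler
`P_{E₁} ⋯ P_{E_K}` has a spectral gap (spectral radius of `P_{E₁}⋯P_{E_K} − P_E` is
less than `1`, where `E = ⋂ᵢ Eᵢ`), then every cycle `P_{F₁}⋯P_{F_g}` and every mixture
`∑ w_d P_{F_d}` of Gibbs steps, where `F_d = ⋂_{i ∈ I_d} E_i` for nonempty proper subsets
`I₁, …, I_g` of `{1,…,K}` covering `{1,…,K}`, has a spectral gap. -/
theorem cycles_and_mixtures_inherit_spectral_gap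
    {K : ℕ} (hK : 2 ≤ K) (E : Fin K → Submodule ℂ H)
    (hEclosed : ∀ i, IsClosed ((E i : Set H)))
    (hEproper : ∀ i, E i ≠ ⊤)
    (hgap : spectralRadius ℂ
      ((List.ofFn fun i => proj (E i) (hEclosed i)).prod
        - proj (⨅ i, E i) (isClosed_iInf hEclosed)) < 1)
    {g : ℕ} (hg : 2 ≤ g) (I : Fin g → Finset (Fin K))
    (hInonempty : ∀ d, (I d).Nonempty) (hIproper : ∀ d, I d ≠ Finset.univ)
    (hIcover : ∀ k, ∃ d, k ∈ I d) :
    spectralRadius ℂ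
      ((List.ofFn fun d => proj (⨅ i ∈ I d, E i) (isClosed_biInf hEclosed (I d))).prod
        - proj (⨅ i, E i) (isClosed_iInf hEclosed)) < 1 ∧
    ∀ w : Fin g → ℝ, (∀ d, 0 < w d) → ∑ d, w d = 1 →
      spectralRadius ℂ
        ((∑ d, (w d : ℂ) • proj (⨅ i ∈ I d, E i) (isClosed_biInf hEclosed (I d)))
          - proj (⨅ i, E i) (isClosed_iInf hEclosed)) < 1 := by
  have hne : Nontrivial H := by
    by_contra hnt
    rw [not_nontrivial_iff_subsingleton] at hnt
    exact hEproper ⟨0, by omega⟩ (Subsingleton.elim _ _)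
  set F : Fin g → H →L[ℂ] H :=
    fun d => proj (⨅ i ∈ I d, E i) (isClosed_biInf hEclosed (I d)) with hF
  have hFpr : ∀ d, IsPr (F d) := fun d => ⟨_, _, rfl⟩
  obtain ⟨C, hC0, hC⟩ := lower_of_gap _ hgap
  -- the key transfer principle
  have key : ∀ (S : H →L[ℂ] H) (c : ℝ), 0 ≤ c → (∀ x, (∀ d, F d x = x) → S x = x) →
      (∀ u, ‖S u‖ ≤ ‖u‖) →
      (∀ d u, ‖u - F d u‖ ^ 2 ≤ c * (‖u‖ ^ 2 - ‖S u‖ ^ 2)) →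
      spectralRadius ℂ (S - proj (⨅ i, E i) (isClosed_iInf hEclosed)) < 1 := by
    intro S c hc hfix hSle hdef
    refine gap_of_defect _ _ S ?_ ((C * K) ^ 2 * c) ?_ hSle
    · intro x hx
      refine hfix x fun d => proj_of_mem _ _ ?_
      simp only [Submodule.mem_iInf] at hx ⊢
      exact fun i _ => hx i
    · intro u hu
      have hnn : 0 ≤ ‖u‖ ^ 2 - ‖S u‖ ^ 2 := by
        have := hSle u
        have : ‖S u‖ ^ 2 ≤ ‖u‖ ^ 2 := by gcongr
        linarith
      have h1 := hC u
      rw [ContinuousLinearMap.sub_apply, hu, sub_zero] at h1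
      have h2 := prod_sub_le (List.ofFn fun i => proj (E i) (hEclosed i))
        (by
          intro T hT
          obtain ⟨i, rfl⟩ := (List.mem_ofFn' _ _).1 hT
          exact ⟨_, _, rfl⟩) u (√(c * (‖u‖ ^ 2 - ‖S u‖ ^ 2)))
        (by
          intro T hT
          obtain ⟨i, rfl⟩ := (List.mem_ofFn' _ _).1 hT
          obtain ⟨d, hd⟩ := hIcover i
          refine le_trans (proj_dist_le (E i) (hEclosed i) u (y := F d u) ?_)
            (Real.le_sqrt_of_sq_le (hdef d u))
          have hm := proj_mem (⨅ i ∈ I d, E i) (isClosed_biInf hEclosed (I d)) u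
          simp only [Submodule.mem_iInf] at hm
          exact hm i hd)
      rw [List.length_ofFn] at h2
      have h3 : ‖u‖ ≤ C * (K * √(c * (‖u‖ ^ 2 - ‖S u‖ ^ 2))) :=
        h1.trans (mul_le_mul_of_nonneg_left h2 hC0)
      calc ‖u‖ ^ 2 ≤ (C * (K * √(c * (‖u‖ ^ 2 - ‖S u‖ ^ 2)))) ^ 2 := by gcongr
        _ = (C * K) ^ 2 * √(c * (‖u‖ ^ 2 - ‖S u‖ ^ 2)) ^ 2 := by ring
        _ = (C * K) ^ 2 * c * (‖u‖ ^ 2 - ‖S u‖ ^ 2) := by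
          rw [Real.sq_sqrt (mul_nonneg hc hnn)]; ring
  have hLpr : ∀ T ∈ List.ofFn F, IsPr T := by
    intro T hT
    obtain ⟨d, rfl⟩ := (List.mem_ofFn' _ _).1 hT
    exact hFpr d
  refine ⟨key _ (2 ^ (List.ofFn F).length) (by positivity) ?_ ?_ ?_, ?_⟩
  · intro x hx
    refine prod_fix _ x fun T hT => ?_
    obtain ⟨d, rfl⟩ := (List.mem_ofFn' _ _).1 hT
    exact hx d
  · intro u
    have h := (prod_defect _ hLpr u).1
    have h0 : 0 ≤ 2 ^ (List.ofFn F).length * (‖u‖ ^ 2 - ‖(List.ofFn F).prod u‖ ^ 2) :=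
      (sq_nonneg _).trans h
    have h1 := nonneg_of_mul_nonneg_right h0 (by positivity)
    exact le_of_sq_le_sq (by linarith) (norm_nonneg _)
  · intro d u
    exact (prod_defect _ hLpr u).2 _ ((List.mem_ofFn' _ _).2 ⟨d, rfl⟩)
  · intro w hw hw1
    have hnn : ∀ u d, 0 ≤ w d * ‖u - F d u‖ ^ 2 := fun u d =>
      mul_nonneg (hw d).le (sq_nonneg _)
    have hdef := mix_defect F hFpr w hw hw1
    have hsum : ∀ u, 0 ≤ ‖u‖ ^ 2 - ‖(∑ d, (w d : ℂ) • F d) u‖ ^ 2 := fun u =>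
      (Finset.sum_nonneg fun d _ => hnn u d).trans (hdef u)
    change spectralRadius ℂ ((∑ d, (w d : ℂ) • F d)
      - proj (⨅ i, E i) (isClosed_iInf hEclosed)) < 1
    refine key _ (∑ d, 1 / w d) (Finset.sum_nonneg fun d _ => (one_div_pos.2 (hw d)).le) ?_ ?_ ?_
    · intro x hx
      have hw1' : ∑ d, (w d : ℂ) = 1 := by exact_mod_cast hw1
      rw [ContinuousLinearMap.sum_apply]
      simp only [ContinuousLinearMap.smul_apply, hx]
      rw [← Finset.sum_smul, hw1', one_smul]
    · intro u
      have := hsum u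
      exact le_of_sq_le_sq (by linarith) (norm_nonneg _)
    · intro d u
      have h1 : w d * ‖u - F d u‖ ^ 2 ≤ ‖u‖ ^ 2 - ‖(∑ d, (w d : ℂ) • F d) u‖ ^ 2 :=
        (Finset.single_le_sum (f := fun d => w d * ‖u - F d u‖ ^ 2)
          (fun d _ => hnn u d) (Finset.mem_univ d)).trans (hdef u)
      have h2 : 1 / w d ≤ ∑ d, 1 / w d :=
        Finset.single_le_sum (f := fun d => 1 / w d)
          (fun d _ => (one_div_pos.2 (hw d)).le) (Finset.mem_univ d)
      calc ‖u - F d u‖ ^ 2 = 1 / w d * (w d * ‖u - F d u‖ ^ 2) := by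
            have := (hw d).ne'
            field_simp
        _ ≤ 1 / w d * (‖u‖ ^ 2 - ‖(∑ d, (w d : ℂ) • F d) u‖ ^ 2) :=
            mul_le_mul_of_nonneg_left h1 (one_div_pos.2 (hw d)).le
        _ ≤ _ := mul_le_mul_of_nonneg_right h2 (hsum u)
end

section
/- Let K ≥ 2 and let E₁,…,E_K be closed proper subspaces of a complex Hilbert space H with E = ⋂_{i=1}^K E_i. Let g ≥ 2, let I₁,…,I_g be nonempty proper subsets of {1,…,K} with ⋃_{d=1}^g I_d = {1,…,K}, and set F_d = ⋂_{i∈I_d} E_i for d = 1,…,g. Then the following assertions are equivalent: (1) there exists a permutation ρ of {1,…,g} such that r(P_{F_{ρ(1)}}⋯P_{F_{ρ(g)}} − P_E) < 1; (2) there exists (w₁,…,w_g) ∈ 𝒮_g such that r(∑_{d=1}^g w_d P_{F_d} − P_E) < 1; (3) there exists a permutation ρ of {1,…,g} such that ‖P_{F_{ρ(1)}}⋯P_{F_{ρ(g)}} − P_E‖ < 1; (4) for every permutation ρ' of {1,…,g}, r(P_{F_{ρ'(1)}}⋯P_{F_{ρ'(g)}} − P_E) < 1; (5) for every (w'₁,…,w'_g)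 ∈ 𝒮_g, r(∑_{d=1}^g w'_d P_{F_d} − P_E) < 1; (6) for every permutation ρ' of {1,…,g}, ‖P_{F_{ρ'(1)}}⋯P_{F_{ρ'(g)}} − P_E‖ < 1. -/
open scoped ENNReal
set_option linter.unusedSectionVars false

variable {H : Type*} [NormedAddCommGroup H] [InnerProductSpace ℂ H] [CompleteSpace H]

namespace Solidarity

lemma le_of_sq {a b : ℝ} (h : a ^ 2 ≤ b ^ 2) (hb : 0 ≤ b) : a ≤ b := by
  by_contra! hc
  nlinarith

/-- Pythagoras identity satisfied by an orthogonal projection. -/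
def Pyth (P : H →L[ℂ] H) : Prop := ∀ x, ‖x‖ ^ 2 = ‖P x‖ ^ 2 + ‖x - P x‖ ^ 2

lemma proj_apply (S : Submodule ℂ H) (hS : IsClosed (S : Set H)) (x : H) :
    haveI : CompleteSpace S := hS.completeSpace_coe
    proj S hS x = (S.orthogonalProjectionOnto x : H) := rfl

lemma proj_mem (S : Submodule ℂ H) (hS : IsClosed (S : Set H)) (x : H) : proj S hS x ∈ S := by
  rw [proj_apply]; exact Subtype.property _

lemma proj_eq (S : Submodule ℂ H) (hS : IsClosed (S : Set H)) (x : H) (hx : x ∈ S) :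
    proj S hS x = x := by
  haveI : CompleteSpace S := hS.completeSpace_coe
  rw [proj_apply]
  exact Submodule.starProjection_eq_self_iff.mpr hx

lemma proj_pyth (S : Submodule ℂ H) (hS : IsClosed (S : Set H)) : Pyth (proj S hS) := by
  haveI : CompleteSpace S := hS.completeSpace_coe
  intro x
  have h1 : inner ℂ (proj S hS x) (x - proj S hS x) = 0 := by
    have := Submodule.sub_starProjection_mem_orthogonal (K := S) x
    exact (Submodule.mem_orthogonal _ _).1 this _ (proj_mem S hS x)
  have h2 := norm_add_sq_eq_norm_sq_add_norm_sq_of_inner_eq_zero _ _ h1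
  rw [add_sub_cancel] at h2
  nlinarith [h2]

lemma Pyth.norm_le {P : H →L[ℂ] H} (hP : Pyth P) (x : H) : ‖P x‖ ≤ ‖x‖ := by
  have := hP x
  exact le_of_sq (by nlinarith [sq_nonneg ‖x - P x‖]) (norm_nonneg _)

lemma Pyth.norm_sub_le {P : H →L[ℂ] H} (hP : Pyth P) (x : H) : ‖x - P x‖ ≤ ‖x‖ := by
  have := hP x
  exact le_of_sq (by nlinarith [sq_nonneg ‖P x‖]) (norm_nonneg _)

lemma list_sub_le (L : List (H →L[ℂ] H)) (hL : ∀ P ∈ L, Pyth P) (x : H) :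
    ‖x - L.prod x‖ ≤ (L.map fun P => ‖x - P x‖).sum := by
  induction L with
  | nil => simp
  | cons P R ih =>
    have ih' := ih fun Q hQ => hL Q (List.mem_cons_of_mem _ hQ)
    have hP := hL P List.mem_cons_self
    simp only [List.prod_cons, List.map_cons, List.sum_cons]
    have e : x - (P * R.prod) x = (x - P x) + P (x - R.prod x) := by
      simp [map_sub]
    rw [e]
    refine (norm_add_le _ _).trans ?_
    have := hP.norm_le (x - R.prod x)
    linarith

lemma list_bound (L : List (H →L[ℂ] H)) (hL : ∀ P ∈ L, Pyth P) :
    ∃ c : ℝ, 0 ≤ c ∧ ∀ x, ∃ s : ℝ, 0 ≤ s ∧ s ^ 2 = ‖x‖ ^ 2 - ‖L.prod x‖ ^ 2 ∧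
      ‖x - L.prod x‖ ≤ c * s ∧ ∀ P ∈ L, ‖x - P x‖ ≤ c * s := by
  induction L with
  | nil => exact ⟨0, le_rfl, fun x => ⟨0, le_rfl, by simp, by simp, by simp⟩⟩
  | cons P R ih =>
    obtain ⟨c, hc, h⟩ := ih fun Q hQ => hL Q (List.mem_cons_of_mem _ hQ)
    have hP := hL P List.mem_cons_self
    refine ⟨2 * c + 1, by linarith, fun x => ?_⟩
    obtain ⟨s, hs, hs2, h1, h2⟩ := h x
    set y := R.prod x with hy
    have hPy := hP y
    have e : (P :: R).prod x = P y := by simp [hy]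
    rw [e]
    have hnn : 0 ≤ s ^ 2 + ‖y - P y‖ ^ 2 := by positivity
    set t := √(s ^ 2 + ‖y - P y‖ ^ 2) with ht
    have ht0 : 0 ≤ t := Real.sqrt_nonneg _
    have ht2 : t ^ 2 = s ^ 2 + ‖y - P y‖ ^ 2 := Real.sq_sqrt hnn
    have hst : s ≤ t := le_of_sq (by rw [ht2]; nlinarith [sq_nonneg ‖y - P y‖]) ht0
    have hyt : ‖y - P y‖ ≤ t := le_of_sq (by rw [ht2]; nlinarith [sq_nonneg s]) ht0
    have hct : c * s ≤ c * t := mul_le_mul_of_nonneg_left hst hc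
    have hct0 : 0 ≤ c * t := mul_nonneg hc ht0
    refine ⟨t, ht0, by rw [ht2]; linarith, ?_, ?_⟩
    · have : x - P y = (x - y) + (y - P y) := by abel
      rw [this]
      refine (norm_add_le _ _).trans ?_
      linarith
    · intro Q hQ
      rcases List.mem_cons.1 hQ with rfl | hQ
      · have : x - Q x = (x - y) + (y - Q y) - Q (x - y) := by rw [map_sub]; abel
        rw [this]
        refine (norm_sub_le _ _).trans ?_
        have a1 := norm_add_le (x - y) (y - Q y)
        have a2 := hP.norm_le (x - y)
        linarith
      · have := h2 Q hQ
        linarith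

lemma radius_lt (A : H →L[ℂ] H) (hA : ‖A‖ < 1) : spectralRadius ℂ A < 1 := by
  have h1 : spectralRadius ℂ A ≤ (‖A‖₊ : ℝ≥0∞) := by
    refine iSup₂_le fun k hk => ?_
    have h := spectrum.norm_le_norm_mul_of_mem hk
    have h2 : ‖(1 : H →L[ℂ] H)‖ ≤ 1 := ContinuousLinearMap.norm_id_le
    have h3 : ‖k‖ ≤ ‖A‖ := h.trans (mul_le_of_le_one_right (norm_nonneg _) h2)
    exact_mod_cast h3
  refine h1.trans_lt ?_
  have : ‖A‖₊ < 1 := by exact_mod_cast hA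
  exact_mod_cast this

lemma gap_of_radius (T Q : H →L[ℂ] H) (h : spectralRadius ℂ (T - Q) < 1) :
    ∃ M : ℝ, 0 ≤ M ∧ ∀ x, Q x = 0 → ‖x‖ ≤ M * ‖x - T x‖ := by
  have h1 : (1 : ℂ) ∉ spectrum ℂ (T - Q) := by
    intro hk
    have : ((‖(1 : ℂ)‖₊ : ℝ≥0∞)) ≤ spectralRadius ℂ (T - Q) :=
      le_iSup₂ (f := fun (k : ℂ) (_ : k ∈ spectrum ℂ (T - Q)) => (‖k‖₊ : ℝ≥0∞)) 1 hk
    simp only [nnnorm_one, ENNReal.coe_one] at this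
    exact absurd h (not_lt.2 this)
  rw [spectrum.notMem_iff, map_one] at h1
  obtain ⟨u, hu⟩ := h1
  refine ⟨‖((u⁻¹ : (H →L[ℂ] H)ˣ) : H →L[ℂ] H)‖, norm_nonneg _, fun x hx => ?_⟩
  have e : ((u⁻¹ : (H →L[ℂ] H)ˣ) : H →L[ℂ] H) (x - T x) = x := by
    have e1 : (u : H →L[ℂ] H) x = x - T x := by rw [hu]; simp [hx]
    rw [← e1, ← mul_apply_eq_comp, Units.inv_mul]
    rfl
  calc ‖x‖ = ‖((u⁻¹ : (H →L[ℂ] H)ˣ) : H →L[ℂ] H) (x - T x)‖ := by rw [e]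
    _ ≤ _ := ContinuousLinearMap.le_opNorm _ _

lemma norm_lt_of_gap (T Q : H →L[ℂ] H) (hTQ : ∀ x, T (Q x) = Q x) (hQQ : ∀ x, Q (Q x) = Q x)
    (hQ : Pyth Q) (N : ℝ) (hN : 1 ≤ N)
    (h : ∀ x, Q x = 0 → ‖x‖ ^ 2 ≤ N * (‖x‖ ^ 2 - ‖T x‖ ^ 2)) : ‖T - Q‖ < 1 := by
  have hN0 : 0 < N := by linarith
  have hb : 0 ≤ 1 - N⁻¹ := by
    have := inv_le_one_of_one_le₀ hN
    linarith
  have hlt : √(1 - N⁻¹) < 1 := by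
    rw [Real.sqrt_lt' one_pos]
    have := inv_pos.2 hN0
    linarith
  refine (ContinuousLinearMap.opNorm_le_bound _ (Real.sqrt_nonneg (1 - N⁻¹)) fun x => ?_).trans_lt hlt
  have e : (T - Q) x = T (x - Q x) := by simp [map_sub, hTQ]
  have hz := h (x - Q x) (by simp [map_sub, hQQ])
  have hle := hQ.norm_sub_le x
  rw [e]
  set z := x - Q x
  have h2 : ‖T z‖ ^ 2 ≤ (1 - N⁻¹) * ‖z‖ ^ 2 := by
    have : N⁻¹ * ‖z‖ ^ 2 ≤ ‖z‖ ^ 2 - ‖T z‖ ^ 2 := by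
      rw [inv_mul_le_iff₀ hN0]; exact hz
    linarith
  have h3 : ‖T z‖ ≤ √(1 - N⁻¹) * ‖z‖ := by
    refine le_of_sq ?_ (by positivity)
    rw [mul_pow, Real.sq_sqrt hb]; exact h2
  exact h3.trans (mul_le_mul_of_nonneg_left hle (Real.sqrt_nonneg _))

/-- The common, order-independent condition. -/
def Gap {g : ℕ} (P : Fin g → H →L[ℂ] H) (Q : H →L[ℂ] H) : Prop :=
  ∃ M : ℝ, 0 ≤ M ∧ ∀ x, Q x = 0 → ‖x‖ ≤ M * ∑ d, ‖x - P d x‖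

variable {g : ℕ} (P : Fin g → H →L[ℂ] H) (Q : H →L[ℂ] H)

lemma gap_of_cycle (hP : ∀ d, Pyth (P d)) (ρ : Equiv.Perm (Fin g))
    (h : spectralRadius ℂ ((List.ofFn fun d => P (ρ d)).prod - Q) < 1) : Gap P Q := by
  obtain ⟨M, hM, h⟩ := gap_of_radius _ _ h
  refine ⟨M, hM, fun x hx => (h x hx).trans (mul_le_mul_of_nonneg_left ?_ hM)⟩
  refine (list_sub_le _ ?_ x).trans_eq ?_
  · intro A hA
    obtain ⟨d, rfl⟩ := (List.mem_ofFn' _ _).1 hA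
    exact hP _
  · rw [List.map_ofFn, List.sum_ofFn]
    exact Equiv.sum_comp ρ fun d => ‖x - P d x‖

lemma sub_mix (w : Fin g → ℝ) (hs : ∑ d, w d = 1) (x : H) :
    x - (∑ d, (w d : ℂ) • P d) x = ∑ d, (w d : ℂ) • (x - P d x) := by
  have : (∑ d, (w d : ℂ)) = 1 := by exact_mod_cast hs
  simp [smul_sub, Finset.sum_sub_distrib, ← Finset.sum_smul, hs]

lemma gap_of_mix (w : Fin g → ℝ) (hw : ∀ d, 0 < w d) (hs : ∑ d, w d = 1)
    (h : spectralRadius ℂ ((∑ d, (w d : ℂ) • P d) - Q) < 1) : Gap P Q := by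
  obtain ⟨M, hM, h⟩ := gap_of_radius _ _ h
  refine ⟨M, hM, fun x hx => (h x hx).trans (mul_le_mul_of_nonneg_left ?_ hM)⟩
  rw [sub_mix P w hs]
  refine (norm_sum_le _ _).trans (Finset.sum_le_sum fun d _ => ?_)
  have h1 : w d ≤ 1 := by
    rw [← hs]; exact Finset.single_le_sum (fun i _ => (hw i).le) (Finset.mem_univ d)
  rw [norm_smul, Complex.norm_real, Real.norm_of_nonneg (hw d).le]
  exact mul_le_of_le_one_left (norm_nonneg _) h1

lemma list_fix (L : List (H →L[ℂ] H)) (y : H) (h : ∀ P ∈ L, P y = y) : L.prod y = y := by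
  induction L with
  | nil => simp
  | cons A R ih =>
    have := ih fun B hB => h B (List.mem_cons_of_mem _ hB)
    simp [this, h A List.mem_cons_self]

lemma cycle_of_gap (hP : ∀ d, Pyth (P d)) (hQ : Pyth Q) (hQQ : ∀ x, Q (Q x) = Q x)
    (hPQ : ∀ d x, P d (Q x) = Q x) (hG : Gap P Q) (ρ : Equiv.Perm (Fin g)) :
    ‖(List.ofFn fun d => P (ρ d)).prod - Q‖ < 1 := by
  obtain ⟨M, hM, h⟩ := hG
  obtain ⟨c, hc, hb⟩ := list_bound (List.ofFn fun d => P (ρ d)) (by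
    intro A hA
    obtain ⟨d, rfl⟩ := (List.mem_ofFn' _ _).1 hA
    exact hP _)
  refine norm_lt_of_gap _ Q (fun x => list_fix _ _ ?_) hQQ hQ (1 + (M * (g * c)) ^ 2)
    (by nlinarith [sq_nonneg (M * (g * c))]) fun x hx => ?_
  · intro A hA
    obtain ⟨d, rfl⟩ := (List.mem_ofFn' _ _).1 hA
    exact hPQ _ _
  · obtain ⟨s, hs, hs2, -, h2⟩ := hb x
    rw [← hs2]
    have h3 : ∑ d, ‖x - P d x‖ ≤ g * (c * s) := by
      calc ∑ d, ‖x - P d x‖ ≤ ∑ _d : Fin g, c * s := by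
            refine Finset.sum_le_sum fun d _ => h2 _ ?_
            exact (List.mem_ofFn' _ _).2 ⟨ρ.symm d, by simp⟩
        _ = g * (c * s) := by simp
    have h4 : ‖x‖ ≤ M * (g * c) * s := by
      have := mul_le_mul_of_nonneg_left h3 hM
      have := h x hx
      nlinarith
    have h5 : ‖x‖ ^ 2 ≤ (M * (g * c) * s) ^ 2 := pow_le_pow_left₀ (norm_nonneg _) h4 2
    nlinarith [sq_nonneg s]

lemma mix_of_gap (hP : ∀ d, Pyth (P d)) (hQ : Pyth Q) (hQQ : ∀ x, Q (Q x) = Q x)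
    (hPQ : ∀ d x, P d (Q x) = Q x) (hG : Gap P Q) 
    (w : Fin g → ℝ) (hw : ∀ d, 0 < w d) (hs : ∑ d, w d = 1) :
    ‖(∑ d, (w d : ℂ) • P d) - Q‖ < 1 := by
  obtain ⟨M, hM, h⟩ := hG
  have hsC : (∑ d, (w d : ℂ)) = 1 := by exact_mod_cast hs
  set W := ∑ d, (w d)⁻¹ with hW
  have hW0 : 0 ≤ W := Finset.sum_nonneg fun d _ => (inv_pos.2 (hw d)).le
  have hWd : ∀ d, 1 ≤ W * w d := fun d => by
    have : (w d)⁻¹ ≤ W :=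
      Finset.single_le_sum (f := fun d => (w d)⁻¹) (fun i _ => (inv_pos.2 (hw i)).le)
        (Finset.mem_univ d)
    rwa [inv_le_iff_one_le_mul₀ (hw d)] at this
  have hK0 : 0 ≤ M ^ 2 * (g * W) := by positivity
  refine norm_lt_of_gap _ Q (fun x => ?_) hQQ hQ (1 + M ^ 2 * (g * W))
    (by linarith) fun x hx => ?_
  · simp [hPQ, ← Finset.sum_smul, hs]
  · have hmix : ‖(∑ d, (w d : ℂ) • P d) x‖ ^ 2 ≤ ∑ d, w d * ‖P d x‖ ^ 2 := by
      have a1 : ‖(∑ d, (w d : ℂ) • P d) x‖ ≤ ∑ d, w d * ‖P d x‖ := by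
        rw [sum_apply]
        refine (norm_sum_le _ _).trans_eq (Finset.sum_congr rfl fun d _ => ?_)
        rw [smul_apply, norm_smul, Complex.norm_real,
          Real.norm_of_nonneg (hw d).le]
      refine (pow_le_pow_left₀ (norm_nonneg _) a1 2).trans ?_
      exact Real.pow_arith_mean_le_arith_mean_pow _ _ _ (fun d _ => (hw d).le) hs
        (fun d _ => norm_nonneg _) 2
    have hsum : ‖x‖ ^ 2 = ∑ d, w d * ‖P d x‖ ^ 2 + ∑ d, w d * ‖x - P d x‖ ^ 2 := by
      rw [← Finset.sum_add_distrib]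
      simp_rw [← mul_add, ← hP _ x, ← Finset.sum_mul, hs, one_mul]
    have hCS : (∑ d, ‖x - P d x‖) ^ 2 ≤ g * ∑ d, ‖x - P d x‖ ^ 2 := by
      have := sq_sum_le_card_mul_sum_sq (s := (Finset.univ : Finset (Fin g)))
        (f := fun d => ‖x - P d x‖)
      simpa using this
    have hWs : ∑ d, ‖x - P d x‖ ^ 2 ≤ W * ∑ d, w d * ‖x - P d x‖ ^ 2 := by
      rw [Finset.mul_sum]
      refine Finset.sum_le_sum fun d _ => ?_
      rw [← mul_assoc]
      exact le_mul_of_one_le_left (sq_nonneg _) (hWd d)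
    set D := ∑ d, w d * ‖x - P d x‖ ^ 2 with hD
    have hD0 : 0 ≤ D := Finset.sum_nonneg fun d _ => mul_nonneg (hw d).le (sq_nonneg _)
    have h5 : ‖x‖ ^ 2 ≤ M ^ 2 * (g * W) * D := by
      calc ‖x‖ ^ 2 ≤ (M * ∑ d, ‖x - P d x‖) ^ 2 := pow_le_pow_left₀ (norm_nonneg _) (h x hx) 2
        _ = M ^ 2 * (∑ d, ‖x - P d x‖) ^ 2 := by ring
        _ ≤ M ^ 2 * (g * (W * D)) := by
            gcongr
            exact hCS.trans (by gcongr)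
        _ = _ := by ring
    have h6 : D ≤ ‖x‖ ^ 2 - ‖(∑ d, (w d : ℂ) • P d) x‖ ^ 2 := by linarith
    calc ‖x‖ ^ 2 ≤ (1 + M ^ 2 * (g * W)) * D := by linarith
      _ ≤ _ := mul_le_mul_of_nonneg_left h6 (by linarith)

end Solidarity

/-- The generalized solidarity principle of the spectral gap for cycles and
mixtures of Gibbs steps: with `F_d = ⋂_{i ∈ I_d} E_i` and `E = ⋂ᵢ Eᵢ`, the six listed
assertions about cycles `P_{F_{ρ(1)}}⋯P_{F_{ρ(g)}}` and mixtures `∑ w_d P_{F_d}` are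
equivalent. -/
theorem generalized_solidarity_principle
    {K : ℕ} (hK : 2 ≤ K) (E : Fin K → Submodule ℂ H)
    (hEclosed : ∀ i, IsClosed ((E i : Set H)))
    (hEproper : ∀ i, E i ≠ ⊤)
    {g : ℕ} (hg : 2 ≤ g) (I : Fin g → Finset (Fin K))
    (hInonempty : ∀ d, (I d).Nonempty) (hIproper : ∀ d, I d ≠ Finset.univ)
    (hIcover : ∀ k, ∃ d, k ∈ I d) :
    List.TFAE
      [ (∃ ρ : Equiv.Perm (Fin g), spectralRadius ℂ
          ((List.ofFn fun d => proj (⨅ i ∈ I (ρ d), E i) (isClosed_biInf hEclosed (I (ρ d)))).prod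
            - proj (⨅ i, E i) (isClosed_iInf hEclosed)) < 1),
        (∃ w : Fin g → ℝ, (∀ d, 0 < w d) ∧ ∑ d, w d = 1 ∧ spectralRadius ℂ
          ((∑ d, (w d : ℂ) • proj (⨅ i ∈ I d, E i) (isClosed_biInf hEclosed (I d)))
            - proj (⨅ i, E i) (isClosed_iInf hEclosed)) < 1),
        (∃ ρ : Equiv.Perm (Fin g),
          ‖(List.ofFn fun d => proj (⨅ i ∈ I (ρ d), E i) (isClosed_biInf hEclosed (I (ρ d)))).prod
            - proj (⨅ i, E i) (isClosed_iInf hEclosed)‖ < 1),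
        (∀ ρ' : Equiv.Perm (Fin g), spectralRadius ℂ
          ((List.ofFn fun d =>
              proj (⨅ i ∈ I (ρ' d), E i) (isClosed_biInf hEclosed (I (ρ' d)))).prod
            - proj (⨅ i, E i) (isClosed_iInf hEclosed)) < 1),
        (∀ w' : Fin g → ℝ, (∀ d, 0 < w' d) → ∑ d, w' d = 1 → spectralRadius ℂ
          ((∑ d, (w' d : ℂ) • proj (⨅ i ∈ I d, E i) (isClosed_biInf hEclosed (I d)))
            - proj (⨅ i, E i) (isClosed_iInf hEclosed)) < 1),
        (∀ ρ' : Equiv.Perm (Fin g),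
          ‖(List.ofFn fun d =>
              proj (⨅ i ∈ I (ρ' d), E i) (isClosed_biInf hEclosed (I (ρ' d)))).prod
            - proj (⨅ i, E i) (isClosed_iInf hEclosed)‖ < 1) ] := by
  have hP : ∀ d, Solidarity.Pyth (proj (⨅ i ∈ I d, E i) (isClosed_biInf hEclosed (I d))) :=
    fun d => Solidarity.proj_pyth _ _
  have hQ := Solidarity.proj_pyth (⨅ i, E i) (isClosed_iInf hEclosed)
  have hQQ : ∀ x, proj (⨅ i, E i) (isClosed_iInf hEclosed)
      (proj (⨅ i, E i) (isClosed_iInf hEclosed) x) = proj (⨅ i, E i) (isClosed_iInf hEclosed) x :=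
    fun x => Solidarity.proj_eq _ _ _ (Solidarity.proj_mem _ _ _)
  have hPQ : ∀ d x, proj (⨅ i ∈ I d, E i) (isClosed_biInf hEclosed (I d))
      (proj (⨅ i, E i) (isClosed_iInf hEclosed) x) = proj (⨅ i, E i) (isClosed_iInf hEclosed) x :=
    fun d x => Solidarity.proj_eq _ _ _
      ((le_iInf₂ fun i _ => iInf_le E i : (⨅ i, E i) ≤ ⨅ i ∈ I d, E i)
        (Solidarity.proj_mem _ _ _))
  generalize hQdef : proj (⨅ i, E i) (isClosed_iInf hEclosed) = Q at *
  have key : ∀ P : Fin g → H →L[ℂ] H, (∀ d, Solidarity.Pyth (P d)) →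
      (∀ d x, P d (Q x) = Q x) → List.TFAE
      [ (∃ ρ : Equiv.Perm (Fin g), spectralRadius ℂ
          ((List.ofFn fun d => P (ρ d)).prod - Q) < 1),
        (∃ w : Fin g → ℝ, (∀ d, 0 < w d) ∧ ∑ d, w d = 1 ∧ spectralRadius ℂ
          ((∑ d, (w d : ℂ) • P d) - Q) < 1),
        (∃ ρ : Equiv.Perm (Fin g), ‖(List.ofFn fun d => P (ρ d)).prod - Q‖ < 1),
        (∀ ρ' : Equiv.Perm (Fin g), spectralRadius ℂ
          ((List.ofFn fun d => P (ρ' d)).prod - Q) < 1),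
        (∀ w' : Fin g → ℝ, (∀ d, 0 < w' d) → ∑ d, w' d = 1 → spectralRadius ℂ
          ((∑ d, (w' d : ℂ) • P d) - Q) < 1),
        (∀ ρ' : Equiv.Perm (Fin g), ‖(List.ofFn fun d => P (ρ' d)).prod - Q‖ < 1) ] := by
    intro P hP hPQ
    tfae_have 1 → 6 := fun ⟨ρ, h⟩ =>
      Solidarity.cycle_of_gap P Q hP hQ hQQ hPQ (Solidarity.gap_of_cycle P Q hP ρ h)
    tfae_have 6 → 4 := fun h ρ => Solidarity.radius_lt _ (h ρ)
    tfae_have 4 → 1 := fun h => ⟨1, h 1⟩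
    tfae_have 6 → 3 := fun h => ⟨1, h 1⟩
    tfae_have 3 → 1 := fun ⟨ρ, h⟩ => ⟨ρ, Solidarity.radius_lt _ h⟩
    tfae_have 1 → 5 := fun ⟨ρ, h⟩ w hw hs => Solidarity.radius_lt _
      (Solidarity.mix_of_gap P Q hP hQ hQQ hPQ (Solidarity.gap_of_cycle P Q hP ρ h) w hw hs)
    tfae_have 5 → 2 := by
      intro h
      have hg0 : (0 : ℝ) < g := by exact_mod_cast (by omega : 0 < g)
      have h1 : ∀ d : Fin g, (0 : ℝ) < (fun _ : Fin g => (g : ℝ)⁻¹) d := fun _ => inv_pos.2 hg0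
      have h2 : ∑ d : Fin g, (fun _ : Fin g => (g : ℝ)⁻¹) d = 1 := by
        simp [hg0.ne']
      exact ⟨_, h1, h2, h _ h1 h2⟩
    tfae_have 2 → 6 := fun ⟨w, hw, hs, h⟩ =>
      Solidarity.cycle_of_gap P Q hP hQ hQQ hPQ (Solidarity.gap_of_mix P Q w hw hs h)
    tfae_finish
  exact key (fun d => proj (⨅ i ∈ I d, E i) (isClosed_biInf hEclosed (I d))) hP hPQ
end

section
/- Let M, N, L be closed subspaces of a complex Hilbert space H with L ⊆ M and L ⊆ N. Then σ(P_M P_N − P_L) = σ(P_N P_M − P_L), and both spectra are contained in the real line ℝ (viewed inside ℂ). -/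
set_option linter.unusedSectionVars false

variable {H : Type*} [NormedAddCommGroup H] [InnerProductSpace ℂ H] [CompleteSpace H]

/-- Spectral facts for a product of two self-adjoint idempotents `a`, `b`. -/
theorem spectrum_mul_real_aux (a b : H →L[ℂ] H) (ha : IsSelfAdjoint a) (hb : IsSelfAdjoint b)
    (haa : a * a = a) :
    spectrum ℂ (a * b) = spectrum ℂ (b * a) ∧
      spectrum ℂ (a * b) ⊆ Set.range (Complex.ofReal) := by
  have hreal : spectrum ℂ (a * b) ⊆ Set.range (Complex.ofReal) := by
    intro z hz
    by_cases h0 : z = 0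
    · exact ⟨0, by simp [h0]⟩
    have h1 : z ∈ spectrum ℂ (a * (a * b)) \ {0} := by
      rw [← mul_assoc, haa]
      exact ⟨hz, h0⟩
    rw [spectrum.nonzero_mul_comm] at h1
    have hsa : IsSelfAdjoint (a * b * a) := by
      rw [isSelfAdjoint_iff, star_mul, star_mul, ha.star_eq, hb.star_eq, mul_assoc]
    exact ⟨z.re, (hsa.mem_spectrum_eq_re h1.1).symm⟩
  refine ⟨?_, hreal⟩
  have hst : b * a = star (a * b) := by rw [star_mul, ha.star_eq, hb.star_eq]
  have hfix : ∀ z ∈ spectrum ℂ (a * b), star z = z := by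
    intro z hz
    obtain ⟨r, rfl⟩ := hreal hz
    exact Complex.conj_ofReal r
  rw [hst, spectrum.map_star]
  ext z
  rw [Set.mem_star]
  constructor
  · intro hz
    rw [hfix z hz]
    exact hz
  · intro hz
    have := hfix _ hz
    rw [star_star] at this
    rw [this]
    exact hz

theorem proj_isSelfAdjoint_aux (S : Submodule ℂ H) (hS : IsClosed (S : Set H)) :
    IsSelfAdjoint (proj S hS) := by
  haveI : CompleteSpace S := hS.completeSpace_coe
  exact isSelfAdjoint_starProjection S

theorem proj_mul_of_le_aux (S T : Submodule ℂ H) (hS : IsClosed (S : Set H))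
    (hT : IsClosed (T : Set H)) (h : T ≤ S) : proj S hS * proj T hT = proj T hT := by
  haveI : CompleteSpace S := hS.completeSpace_coe
  haveI : CompleteSpace T := hT.completeSpace_coe
  ext x
  exact Submodule.starProjection_eq_self_iff.2 (h (Submodule.starProjection_apply_mem T x))

theorem proj_mul_of_le_aux' (S T : Submodule ℂ H) (hS : IsClosed (S : Set H))
    (hT : IsClosed (T : Set H)) (h : T ≤ S) : proj T hT * proj S hS = proj T hT := by
  have := congrArg star (proj_mul_of_le_aux S T hS hT h)
  rwa [star_mul, (proj_isSelfAdjoint_aux S hS).star_eq,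
    (proj_isSelfAdjoint_aux T hT).star_eq] at this

/-- For closed subspaces `M, N, L` with `L ⊆ M` and `L ⊆ N`, the spectra
of `P_M P_N − P_L` and `P_N P_M − P_L` coincide and are contained in the real line. -/
theorem spectrum_projMul_sub_proj_comm
    (M N L : Submodule ℂ H)
    (hM : IsClosed ((M : Set H))) (hN : IsClosed ((N : Set H))) (hL : IsClosed ((L : Set H)))
    (hLM : L ≤ M) (hLN : L ≤ N) :
    spectrum ℂ (proj M hM * proj N hN - proj L hL) =
      spectrum ℂ (proj N hN * proj M hM - proj L hL) ∧
    spectrum ℂ (proj M hM * proj N hN - proj L hL) ⊆ Set.range (Complex.ofReal) := by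
  have h1 := proj_mul_of_le_aux M L hM hL hLM
  have h2 := proj_mul_of_le_aux' M L hM hL hLM
  have h3 := proj_mul_of_le_aux N L hN hL hLN
  have h4 := proj_mul_of_le_aux' N L hN hL hLN
  have h5 := proj_mul_of_le_aux L L hL hL le_rfl
  have h6 := proj_mul_of_le_aux M M hM hM le_rfl
  have e1 : proj M hM * proj N hN - proj L hL =
      (proj M hM - proj L hL) * (proj N hN - proj L hL) := by
    rw [sub_mul, mul_sub, mul_sub, h1, h4, h5]
    abel
  have e2 : proj N hN * proj M hM - proj L hL =
      (proj N hN - proj L hL) * (proj M hM - proj L hL) := by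
    rw [sub_mul, mul_sub, mul_sub, h3, h2, h5]
    abel
  rw [e1, e2]
  refine spectrum_mul_real_aux _ _
    ((proj_isSelfAdjoint_aux M hM).sub (proj_isSelfAdjoint_aux L hL))
    ((proj_isSelfAdjoint_aux N hN).sub (proj_isSelfAdjoint_aux L hL)) ?_
  rw [sub_mul, mul_sub, mul_sub, h1, h2, h5, h6]
  abel
end

section
/- Let N ≥ 2 and let M₁,…,M_N be closed proper subspaces of a complex Hilbert space H, with M = ⋂_{i=1}^N M_i. If there exists (w₁,…,w_N) ∈ 𝒮_N such that ‖∑_{i=1}^N w_i P_{M_i} − P_M‖ < 1, then for every (w'₁,…,w'_N) ∈ 𝒮_N one has ‖∑_{i=1}^N w'_i P_{M_i} − P_M‖ < 1. -/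
set_option linter.unusedSectionVars false

variable {H : Type*} [NormedAddCommGroup H] [InnerProductSpace ℂ H] [CompleteSpace H]

lemma norm_proj_sub_le (S T : Submodule ℂ H) (hS : IsClosed (S : Set H)) (hT : IsClosed (T : Set H))
    (h : T ≤ S) : ‖proj S hS - proj T hT‖ ≤ 1 := by
  haveI : CompleteSpace S := hS.completeSpace_coe
  haveI : CompleteSpace T := hT.completeSpace_coe
  have e1 : proj S hS = S.starProjection := rfl
  have e2 : proj T hT = T.starProjection := rfl
  rw [e1, e2]
  refine ContinuousLinearMap.opNorm_le_bound _ zero_le_one fun x => ?_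
  have h1 : S.starProjection (T.starProjection x) = T.starProjection x :=
    Submodule.starProjection_eq_self_iff.2 (h (Submodule.starProjection_apply_mem T x))
  have h2 : (S.starProjection - T.starProjection) x
      = S.starProjection (Tᗮ.starProjection x) := by
    rw [Submodule.starProjection_orthogonal_val, map_sub, h1]
    rfl
  rw [h2, one_mul]
  exact (Submodule.norm_starProjection_apply_le S _).trans
    (Submodule.norm_starProjection_apply_le _ _)

/-- If `‖∑ wᵢ P_{Mᵢ} − P_M‖ < 1` for some strictly positive weights summing
to one, then the same holds for every such choice of weights. -/
theorem norm_mixture_lt_one_of_exists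
    {N : ℕ} (hN : 2 ≤ N) (M : Fin N → Submodule ℂ H)
    (hMc : ∀ i, IsClosed ((M i : Set H))) (hMp : ∀ i, M i ≠ ⊤)
    (hex : ∃ w : Fin N → ℝ, (∀ i, 0 < w i) ∧ ∑ i, w i = 1 ∧
      ‖(∑ i, (w i : ℂ) • proj (M i) (hMc i)) - proj (⨅ i, M i) (isClosed_iInf hMc)‖ < 1) :
    ∀ w' : Fin N → ℝ, (∀ i, 0 < w' i) → ∑ i, w' i = 1 →
      ‖(∑ i, (w' i : ℂ) • proj (M i) (hMc i)) - proj (⨅ i, M i) (isClosed_iInf hMc)‖ < 1 := by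
  obtain ⟨w, hw, hw1, hlt⟩ := hex
  intro w' hw' hw1'
  set P := proj (⨅ i, M i) (isClosed_iInf hMc) with hP
  have key : ∀ v : Fin N → ℝ, ∑ i, v i = 1 →
      (∑ i, (v i : ℂ) • proj (M i) (hMc i)) - P
        = ∑ i, (v i : ℂ) • (proj (M i) (hMc i) - P) := by
    intro v hv
    have : (∑ i, (v i : ℂ)) = 1 := by exact_mod_cast hv
    simp only [smul_sub, Finset.sum_sub_distrib, ← Finset.sum_smul, this, one_smul]
  have hQ : ∀ i, ‖proj (M i) (hMc i) - P‖ ≤ 1 := fun i =>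
    norm_proj_sub_le _ _ _ _ (iInf_le _ _)
  obtain ⟨j, -, hj⟩ := Finset.exists_min_image Finset.univ w' ⟨⟨0, by omega⟩, Finset.mem_univ _⟩
  have hle : ∀ i, 0 ≤ w' i - w' j * w i := by
    intro i
    have a : w i ≤ 1 := hw1 ▸ Finset.single_le_sum (fun k _ => (hw k).le) (Finset.mem_univ i)
    have b := hj i (Finset.mem_univ i)
    nlinarith [hw' j]
  rw [key w hw1] at hlt
  rw [key w' hw1']
  have split : ∑ i, (w' i : ℂ) • (proj (M i) (hMc i) - P)
      = (w' j : ℂ) • ∑ i, (w i : ℂ) • (proj (M i) (hMc i) - P)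
        + ∑ i, ((w' i - w' j * w i : ℝ) : ℂ) • (proj (M i) (hMc i) - P) := by
    rw [Finset.smul_sum, ← Finset.sum_add_distrib]
    refine Finset.sum_congr rfl fun i _ => ?_
    rw [smul_smul, ← add_smul]
    congr 1
    push_cast
    ring
  have h2 : ‖∑ i, ((w' i - w' j * w i : ℝ) : ℂ) • (proj (M i) (hMc i) - P)‖ ≤ 1 - w' j := by
    calc _ ≤ ∑ i, (w' i - w' j * w i) := by
          refine norm_sum_le_of_le _ fun i _ => ?_
          rw [norm_smul, Complex.norm_real, Real.norm_of_nonneg (hle i)]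
          exact mul_le_of_le_one_right (hle i) (hQ i)
      _ = 1 - w' j := by
          rw [Finset.sum_sub_distrib, ← Finset.mul_sum, hw1, hw1', mul_one]
  rw [split]
  refine (norm_add_le _ _).trans_lt ?_
  rw [norm_smul, Complex.norm_real, Real.norm_of_nonneg (hw' j).le]
  have := mul_lt_mul_of_pos_left hlt (hw' j)
  linarith
end
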